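/- In the λ̄μμ̃-calculus with explicit substitutions, the expansion Ateb preserves typing: if c:(Γ⊢Δ) then Ateb(c):(Γ⊢Δ); if Γ⊢v:A|Δ then Γ⊢Ateb(v):A|Δ; and if Γ|e:A⊢Δ then Γ|Ateb(e):A⊢Δ. -/

import Mathlib

namespace LambdaBarMuMuTilde

/-- Types: base types, arrow `A → B` and difference `A − B`. -/
inductive Ty : Type
  | base : Ty
  | arrow : Ty → Ty → Ty
  | diff : Ty → Ty → Ty

mutual
/-- Commands `c ::= ⟨v|e⟩ | cτ`. -/
inductive Cmd : Type
  | cut : Tv → Te → Cmd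
  | csub : Cmd → Su → Cmd

/-- Terms `v ::= x | λx.v | e·v | μα.c | vτ`. -/
inductive Tv : Type
  | tvar : ℕ → Tv
  | lam : ℕ → Tv → Tv
  | edot : Te → Tv → Tv
  | mu : ℕ → Cmd → Tv
  | vsub : Tv → Su → Tv

/-- Contexts `e ::= α | αλ.e | v·e | μ̃x.c | eτ`. -/
inductive Te : Type
  | cvar : ℕ → Te
  | colam : ℕ → Te → Te
  | vdot : Tv → Te → Te
  | mut : ℕ → Cmd → Te
  | esub : Te → Su → Te

/-- Explicit substitutions `τ ::= [x←v] | [α←e]`. -/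
inductive Su : Type
  | ts : ℕ → Tv → Su
  | cs : ℕ → Te → Su
end

/-- Typing environments. -/
abbrev Env := ℕ → Option Ty

mutual
/-- Typing of commands: `TypC Γ c Δ` is `c : (Γ ⊢ Δ)`. -/
inductive TypC : Env → Cmd → Env → Prop
  | cut {Γ Δ : Env} {v : Tv} {e : Te} {A : Ty} :
      TypV Γ v A Δ → TypE Γ e A Δ → TypC Γ (.cut v e) Δ
  | csub {Γ Δ Γ' Δ' : Env} {c : Cmd} {τ : Su} :
      TypC Γ c Δ → TypS τ Γ Δ Γ' Δ' → TypC Γ' (.csub c τ) Δ'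

/-- Typing of terms: `TypV Γ v A Δ` is `Γ ⊢ v : A | Δ`. -/
inductive TypV : Env → Tv → Ty → Env → Prop
  | tvar {Γ Δ : Env} {x : ℕ} {A : Ty} : Γ x = some A → TypV Γ (.tvar x) A Δ
  | lam {Γ Δ : Env} {x : ℕ} {v : Tv} {A B : Ty} :
      TypV (Function.update Γ x (some A)) v B Δ →
      TypV Γ (.lam x v) (.arrow A B) Δ
  | edot {Γ Δ : Env} {v : Tv} {e : Te} {A B : Ty} :
      TypV Γ v B Δ → TypE Γ e A Δ → TypV Γ (.edot e v) (.diff A B) Δ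
  | mu {Γ Δ : Env} {a : ℕ} {c : Cmd} {A : Ty} :
      TypC Γ c (Function.update Δ a (some A)) → TypV Γ (.mu a c) A Δ
  | vsub {Γ Δ Γ' Δ' : Env} {v : Tv} {τ : Su} {A : Ty} :
      TypV Γ v A Δ → TypS τ Γ Δ Γ' Δ' → TypV Γ' (.vsub v τ) A Δ'

/-- Typing of contexts: `TypE Γ e A Δ` is `Γ | e : A ⊢ Δ`. -/
inductive TypE : Env → Te → Ty → Env → Prop
  | cvar {Γ Δ : Env} {a : ℕ} {A : Ty} : Δ a = some A → TypE Γ (.cvar a) A Δ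
  | colam {Γ Δ : Env} {a : ℕ} {e : Te} {A B : Ty} :
      TypE Γ e B (Function.update Δ a (some A)) →
      TypE Γ (.colam a e) (.diff A B) Δ
  | vdot {Γ Δ : Env} {v : Tv} {e : Te} {A B : Ty} :
      TypV Γ v A Δ → TypE Γ e B Δ → TypE Γ (.vdot v e) (.arrow A B) Δ
  | mut {Γ Δ : Env} {x : ℕ} {c : Cmd} {A : Ty} :
      TypC (Function.update Γ x (some A)) c Δ → TypE Γ (.mut x c) A Δ
  | esub {Γ Δ Γ' Δ' : Env} {e : Te} {τ : Su} {A : Ty} :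
      TypE Γ e A Δ → TypS τ Γ Δ Γ' Δ' → TypE Γ' (.esub e τ) A Δ'

/-- Typing of substitutions: `TypS τ Γ Δ Γ' Δ'` is
`τ : (Γ ⊢ Δ) ⇒ (Γ' ⊢ Δ')`. -/
inductive TypS : Su → Env → Env → Env → Env → Prop
  | ts {Γ Δ : Env} {x : ℕ} {v : Tv} {A : Ty} :
      TypV Γ v A Δ → TypS (.ts x v) (Function.update Γ x (some A)) Δ Γ Δ
  | cs {Γ Δ : Env} {a : ℕ} {e : Te} {A : Ty} :
      TypE Γ e A Δ → TypS (.cs a e) Γ (Function.update Δ a (some A)) Γ Δ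
end

-- Maximum of all variable indices (term variables and context variables,
-- free or bound) occurring in a syntactic object; used to pick fresh
-- variables.
mutual
def mvC : Cmd → ℕ
  | .cut v e => max (mvV v) (mvE e)
  | .csub c τ => max (mvC c) (mvS τ)
def mvV : Tv → ℕ
  | .tvar x => x
  | .lam x v => max x (mvV v)
  | .edot e v => max (mvE e) (mvV v)
  | .mu a c => max a (mvC c)
  | .vsub v τ => max (mvV v) (mvS τ)
def mvE : Te → ℕ
  | .cvar a => a
  | .colam a e => max a (mvE e)
  | .vdot v e => max (mvV v) (mvE e)
  | .mut x c => max x (mvC c)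
  | .esub e τ => max (mvE e) (mvS τ)
def mvS : Su → ℕ
  | .ts x v => max x (mvV v)
  | .cs a e => max a (mvE e)
end

mutual
/-- The expansion `Ateb` on commands. -/
def AtebC : Cmd → Cmd
  | .cut v e => .cut (AtebV v) (AtebE e)
  | .csub c (.ts x v) => .cut (AtebV v) (.mut x (AtebC c))
  | .csub c (.cs a e) => .cut (.mu a (AtebC c)) (AtebE e)

/-- The expansion `Ateb` on terms (the variables `α`, `β` below are chosen
fresh). -/
def AtebV : Tv → Tv
  | .tvar x => .tvar x
  | .lam x v => .lam x (AtebV v)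
  | .edot e v => .edot (AtebE e) (AtebV v)
  | .mu a c => .mu a (AtebC c)
  | .vsub v (.ts x v') =>
      let w := AtebV v
      let w' := AtebV v'
      let a := max (max (mvV w) (mvV w')) x + 1
      .mu a (.cut (.lam x w) (.vdot w' (.cvar a)))
  | .vsub v (.cs a e) =>
      let w := AtebV v
      let f := AtebE e
      let b := max (max (mvV w) (mvE f)) a + 1
      .mu b (.cut (.mu a (.cut w (.cvar b))) f)

/-- The expansion `Ateb` on contexts (the variables `y`, `x` below are
chosen fresh). -/
def AtebE : Te → Te
  | .cvar a => .cvar a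
  | .colam a e => .colam a (AtebE e)
  | .vdot v e => .vdot (AtebV v) (AtebE e)
  | .mut x c => .mut x (AtebC c)
  | .esub e (.ts x v) =>
      let f := AtebE e
      let w := AtebV v
      let y := max (max (mvE f) (mvV w)) x + 1
      .mut y (.cut w (.mut x (.cut (.tvar y) f)))
  | .esub e (.cs a e') =>
      let f := AtebE e
      let f' := AtebE e'
      let x := max (max (mvE f) (mvE f')) a + 1
      .mut x (.cut (.edot f' (.tvar x)) (.colam a f))
end

mutual
/-- Commands containing no explicit substitution. -/
inductive NoSubC : Cmd → Prop
  | cut {v : Tv} {e : Te} : NoSubV v → NoSubE e → NoSubC (.cut v e)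

/-- Terms containing no explicit substitution. -/
inductive NoSubV : Tv → Prop
  | tvar (x : ℕ) : NoSubV (.tvar x)
  | lam {v : Tv} (x : ℕ) : NoSubV v → NoSubV (.lam x v)
  | edot {e : Te} {v : Tv} : NoSubE e → NoSubV v → NoSubV (.edot e v)
  | mu {c : Cmd} (a : ℕ) : NoSubC c → NoSubV (.mu a c)

/-- Contexts containing no explicit substitution. -/
inductive NoSubE : Te → Prop
  | cvar (a : ℕ) : NoSubE (.cvar a)
  | colam {e : Te} (a : ℕ) : NoSubE e → NoSubE (.colam a e)
  | vdot {v : Tv} {e : Te} : NoSubV v → NoSubE e → NoSubE (.vdot v e)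
  | mut {c : Cmd} (x : ℕ) : NoSubC c → NoSubE (.mut x c)
end

-- Free term variables.
mutual
def ftvC : Cmd → Finset ℕ
  | .cut v e => ftvV v ∪ ftvE e
  | .csub c (.ts x v) => (ftvC c \ {x}) ∪ ftvV v
  | .csub c (.cs _ e) => ftvC c ∪ ftvE e
def ftvV : Tv → Finset ℕ
  | .tvar x => {x}
  | .lam x v => ftvV v \ {x}
  | .edot e v => ftvE e ∪ ftvV v
  | .mu _ c => ftvC c
  | .vsub v (.ts x w) => (ftvV v \ {x}) ∪ ftvV w
  | .vsub v (.cs _ e) => ftvV v ∪ ftvE e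
def ftvE : Te → Finset ℕ
  | .cvar _ => ∅
  | .colam _ e => ftvE e
  | .vdot v e => ftvV v ∪ ftvE e
  | .mut x c => ftvC c \ {x}
  | .esub e (.ts x w) => (ftvE e \ {x}) ∪ ftvV w
  | .esub e (.cs _ e') => ftvE e ∪ ftvE e'
end

-- Free context variables.
mutual
def fcvC : Cmd → Finset ℕ
  | .cut v e => fcvV v ∪ fcvE e
  | .csub c (.ts _ v) => fcvC c ∪ fcvV v
  | .csub c (.cs a e) => (fcvC c \ {a}) ∪ fcvE e
def fcvV : Tv → Finset ℕ
  | .tvar _ => ∅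
  | .lam _ v => fcvV v
  | .edot e v => fcvE e ∪ fcvV v
  | .mu a c => fcvC c \ {a}
  | .vsub v (.ts _ w) => fcvV v ∪ fcvV w
  | .vsub v (.cs a e) => (fcvV v \ {a}) ∪ fcvE e
def fcvE : Te → Finset ℕ
  | .cvar a => {a}
  | .colam a e => fcvE e \ {a}
  | .vdot v e => fcvV v ∪ fcvE e
  | .mut _ c => fcvC c
  | .esub e (.ts _ w) => fcvE e ∪ fcvV w
  | .esub e (.cs a e') => (fcvE e \ {a}) ∪ fcvE e'
end

mutual
/-- Reduction of commands, closed under arbitrary contexts. -/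
inductive RedC : Cmd → Cmd → Prop
  -- (β)
  | beta {x : ℕ} {v v' : Tv} {e : Te} :
      RedC (.cut (.lam x v) (.vdot v' e)) (.cut v' (.mut x (.cut v e)))
  -- (β̃)
  | tbeta {a : ℕ} {v : Tv} {e e' : Te} :
      RedC (.cut (.edot e' v) (.colam a e)) (.cut (.mu a (.cut v e)) e')
  -- (μ)
  | mu {a : ℕ} {c : Cmd} {e : Te} :
      RedC (.cut (.mu a c) e) (.csub c (.cs a e))
  -- (μ̃)
  | mut {x : ℕ} {c : Cmd} {v : Tv} :
      RedC (.cut v (.mut x c)) (.csub c (.ts x v))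
  -- (cτ)
  | ctau {v : Tv} {e : Te} {τ : Su} :
      RedC (.csub (.cut v e) τ) (.cut (.vsub v τ) (.esub e τ))
  -- congruences
  | cutl {v v' : Tv} {e : Te} : RedV v v' → RedC (.cut v e) (.cut v' e)
  | cutr {v : Tv} {e e' : Te} : RedE e e' → RedC (.cut v e) (.cut v e')
  | csubc {c c' : Cmd} {τ : Su} : RedC c c' → RedC (.csub c τ) (.csub c' τ)
  | csubs {c : Cmd} {τ τ' : Su} : RedS τ τ' → RedC (.csub c τ) (.csub c τ')

/-- Reduction of terms, closed under arbitrary contexts. -/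
inductive RedV : Tv → Tv → Prop
  -- (xτ1)
  | xtau1 {x : ℕ} {v : Tv} : RedV (.vsub (.tvar x) (.ts x v)) v
  -- (xτ2)
  | xtau2_ts {x y : ℕ} {v : Tv} : x ≠ y →
      RedV (.vsub (.tvar x) (.ts y v)) (.tvar x)
  | xtau2_cs {x a : ℕ} {e : Te} : RedV (.vsub (.tvar x) (.cs a e)) (.tvar x)
  -- (·̃τ)
  | tdottau {e : Te} {v : Tv} {τ : Su} :
      RedV (.vsub (.edot e v) τ) (.edot (.esub e τ) (.vsub v τ))
  -- (λτ), with α-conversion where necessary: the bound variable is taken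
  -- away from the substitution
  | lamtau_ts {x y : ℕ} {v w : Tv} : x ≠ y → x ∉ ftvV w →
      RedV (.vsub (.lam x v) (.ts y w)) (.lam x (.vsub v (.ts y w)))
  | lamtau_cs {x a : ℕ} {v : Tv} {e : Te} : x ∉ ftvE e →
      RedV (.vsub (.lam x v) (.cs a e)) (.lam x (.vsub v (.cs a e)))
  -- (μτ)
  | mutau_ts {a x : ℕ} {c : Cmd} {w : Tv} : a ∉ fcvV w →
      RedV (.vsub (.mu a c) (.ts x w)) (.mu a (.csub c (.ts x w)))
  | mutau_cs {a b : ℕ} {c : Cmd} {e : Te} : a ≠ b → a ∉ fcvE e →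
      RedV (.vsub (.mu a c) (.cs b e)) (.mu a (.csub c (.cs b e)))
  -- (sv)
  | sv {a : ℕ} {v : Tv} : a ∉ fcvV v → RedV (.mu a (.cut v (.cvar a))) v
  -- congruences
  | lam {x : ℕ} {v v' : Tv} : RedV v v' → RedV (.lam x v) (.lam x v')
  | edotl {e e' : Te} {v : Tv} : RedE e e' → RedV (.edot e v) (.edot e' v)
  | edotr {e : Te} {v v' : Tv} : RedV v v' → RedV (.edot e v) (.edot e v')
  | mu {a : ℕ} {c c' : Cmd} : RedC c c' → RedV (.mu a c) (.mu a c')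
  | vsubv {v v' : Tv} {τ : Su} : RedV v v' → RedV (.vsub v τ) (.vsub v' τ)
  | vsubs {v : Tv} {τ τ' : Su} : RedS τ τ' → RedV (.vsub v τ) (.vsub v τ')

/-- Reduction of contexts, closed under arbitrary contexts. -/
inductive RedE : Te → Te → Prop
  -- (ατ1)
  | atau1 {a : ℕ} {e : Te} : RedE (.esub (.cvar a) (.cs a e)) e
  -- (ατ2)
  | atau2_cs {a b : ℕ} {e : Te} : a ≠ b →
      RedE (.esub (.cvar a) (.cs b e)) (.cvar a)
  | atau2_ts {a x : ℕ} {v : Tv} : RedE (.esub (.cvar a) (.ts x v)) (.cvar a)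
  -- (·τ)
  | vdottau {v : Tv} {e : Te} {τ : Su} :
      RedE (.esub (.vdot v e) τ) (.vdot (.vsub v τ) (.esub e τ))
  -- (λ̃τ)
  | colamtau_ts {a x : ℕ} {e : Te} {w : Tv} : a ∉ fcvV w →
      RedE (.esub (.colam a e) (.ts x w)) (.colam a (.esub e (.ts x w)))
  | colamtau_cs {a b : ℕ} {e e' : Te} : a ≠ b → a ∉ fcvE e' →
      RedE (.esub (.colam a e) (.cs b e')) (.colam a (.esub e (.cs b e')))
  -- (μ̃τ)
  | muttau_ts {x y : ℕ} {c : Cmd} {w : Tv} : x ≠ y → x ∉ ftvV w →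
      RedE (.esub (.mut x c) (.ts y w)) (.mut x (.csub c (.ts y w)))
  | muttau_cs {x a : ℕ} {c : Cmd} {e : Te} : x ∉ ftvE e →
      RedE (.esub (.mut x c) (.cs a e)) (.mut x (.csub c (.cs a e)))
  -- (se)
  | se {x : ℕ} {e : Te} : x ∉ ftvE e → RedE (.mut x (.cut (.tvar x) e)) e
  -- congruences
  | colam {a : ℕ} {e e' : Te} : RedE e e' → RedE (.colam a e) (.colam a e')
  | vdotl {v v' : Tv} {e : Te} : RedV v v' → RedE (.vdot v e) (.vdot v' e)
  | vdotr {v : Tv} {e e' : Te} : RedE e e' → RedE (.vdot v e) (.vdot v e')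
  | mut {x : ℕ} {c c' : Cmd} : RedC c c' → RedE (.mut x c) (.mut x c')
  | esube {e e' : Te} {τ : Su} : RedE e e' → RedE (.esub e τ) (.esub e' τ)
  | esubs {e : Te} {τ τ' : Su} : RedS τ τ' → RedE (.esub e τ) (.esub e τ')

/-- Reduction inside explicit substitutions. -/
inductive RedS : Su → Su → Prop
  | ts {x : ℕ} {v v' : Tv} : RedV v v' → RedS (.ts x v) (.ts x v')
  | cs {a : ℕ} {e e' : Te} : RedE e e' → RedS (.cs a e) (.cs a e')
end

theorem eqOn_update {Γ Γ' : Env} {s : Set ℕ} (h : Set.EqOn Γ Γ' s) (x : ℕ) (o : Option Ty) :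
    Set.EqOn (Function.update Γ x o) (Function.update Γ' x o) s := by
  intro i hi
  by_cases hx : i = x
  · subst hx; simp
  · simp [hx, h hi]

theorem eqOn_update_of_lt (Γ : Env) {n x : ℕ} (h : n < x) (o : Option Ty) :
    Set.EqOn Γ (Function.update Γ x o) (Set.Iic n) := by
  intro i hi
  rw [Function.update_of_ne (lt_of_le_of_lt hi h).ne]

/- Typing depends only on the part of the environments below a bound for the variables. -/
mutual
theorem TypC.of_eqOn {n : ℕ} {Γ Γ' Δ Δ' : Env} : (c : Cmd) → TypC Γ c Δ → mvC c ≤ n →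
    Set.EqOn Γ Γ' (Set.Iic n) → Set.EqOn Δ Δ' (Set.Iic n) → TypC Γ' c Δ'
  | .cut v e, h, hn, hΓ, hΔ => by
    simp only [mvC, max_le_iff] at hn
    cases h with
    | cut hv he => exact .cut (hv.of_eqOn v hn.1 hΓ hΔ) (he.of_eqOn e hn.2 hΓ hΔ)
  | .csub c (.ts x v), h, hn, hΓ, hΔ => by
    simp only [mvC, mvS, max_le_iff] at hn
    cases h with
    | csub hc hτ =>
      cases hτ with
      | ts hv =>
        exact .csub (hc.of_eqOn c hn.1 (eqOn_update hΓ _ _) hΔ) (.ts (hv.of_eqOn v hn.2.2 hΓ hΔ))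
  | .csub c (.cs a e), h, hn, hΓ, hΔ => by
    simp only [mvC, mvS, max_le_iff] at hn
    cases h with
    | csub hc hτ =>
      cases hτ with
      | cs he =>
        exact .csub (hc.of_eqOn c hn.1 hΓ (eqOn_update hΔ _ _)) (.cs (he.of_eqOn e hn.2.2 hΓ hΔ))

theorem TypV.of_eqOn {n : ℕ} {Γ Γ' Δ Δ' : Env} {A : Ty} : (v : Tv) → TypV Γ v A Δ → mvV v ≤ n →
    Set.EqOn Γ Γ' (Set.Iic n) → Set.EqOn Δ Δ' (Set.Iic n) → TypV Γ' v A Δ'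
  | .tvar x, h, hn, hΓ, _ => by
    cases h with
    | tvar hx => exact .tvar ((hΓ hn).symm.trans hx)
  | .lam x v, h, hn, hΓ, hΔ => by
    simp only [mvV, max_le_iff] at hn
    cases h with
    | lam hv => exact .lam (hv.of_eqOn v hn.2 (eqOn_update hΓ _ _) hΔ)
  | .edot e v, h, hn, hΓ, hΔ => by
    simp only [mvV, max_le_iff] at hn
    cases h with
    | edot hv he => exact .edot (hv.of_eqOn v hn.2 hΓ hΔ) (he.of_eqOn e hn.1 hΓ hΔ)
  | .mu a c, h, hn, hΓ, hΔ => by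
    simp only [mvV, max_le_iff] at hn
    cases h with
    | mu hc => exact .mu (hc.of_eqOn c hn.2 hΓ (eqOn_update hΔ _ _))
  | .vsub v (.ts x w), h, hn, hΓ, hΔ => by
    simp only [mvV, mvS, max_le_iff] at hn
    cases h with
    | vsub hv hτ =>
      cases hτ with
      | ts hw =>
        exact .vsub (hv.of_eqOn v hn.1 (eqOn_update hΓ _ _) hΔ) (.ts (hw.of_eqOn w hn.2.2 hΓ hΔ))
  | .vsub v (.cs a e), h, hn, hΓ, hΔ => by
    simp only [mvV, mvS, max_le_iff] at hn
    cases h with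
    | vsub hv hτ =>
      cases hτ with
      | cs he =>
        exact .vsub (hv.of_eqOn v hn.1 hΓ (eqOn_update hΔ _ _)) (.cs (he.of_eqOn e hn.2.2 hΓ hΔ))

theorem TypE.of_eqOn {n : ℕ} {Γ Γ' Δ Δ' : Env} {A : Ty} : (e : Te) → TypE Γ e A Δ → mvE e ≤ n →
    Set.EqOn Γ Γ' (Set.Iic n) → Set.EqOn Δ Δ' (Set.Iic n) → TypE Γ' e A Δ'
  | .cvar a, h, hn, _, hΔ => by
    cases h with
    | cvar ha => exact .cvar ((hΔ hn).symm.trans ha)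
  | .colam a e, h, hn, hΓ, hΔ => by
    simp only [mvE, max_le_iff] at hn
    cases h with
    | colam he => exact .colam (he.of_eqOn e hn.2 hΓ (eqOn_update hΔ _ _))
  | .vdot v e, h, hn, hΓ, hΔ => by
    simp only [mvE, max_le_iff] at hn
    cases h with
    | vdot hv he => exact .vdot (hv.of_eqOn v hn.1 hΓ hΔ) (he.of_eqOn e hn.2 hΓ hΔ)
  | .mut x c, h, hn, hΓ, hΔ => by
    simp only [mvE, max_le_iff] at hn
    obtain _ | _ | _ | hc := h
    exact .mut (hc.of_eqOn c hn.2 (eqOn_update hΓ _ _) hΔ)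
  | .esub e (.ts x w), h, hn, hΓ, hΔ => by
    simp only [mvE, mvS, max_le_iff] at hn
    cases h with
    | esub he hτ =>
      cases hτ with
      | ts hw =>
        exact .esub (he.of_eqOn e hn.1 (eqOn_update hΓ _ _) hΔ) (.ts (hw.of_eqOn w hn.2.2 hΓ hΔ))
  | .esub e (.cs a f), h, hn, hΓ, hΔ => by
    simp only [mvE, mvS, max_le_iff] at hn
    cases h with
    | esub he hτ =>
      cases hτ with
      | cs hf =>
        exact .esub (he.of_eqOn e hn.1 hΓ (eqOn_update hΔ _ _)) (.cs (hf.of_eqOn f hn.2.2 hΓ hΔ))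
end

theorem TypV.update_left {Γ Δ : Env} {v : Tv} {A : Ty} (h : TypV Γ v A Δ) {x : ℕ}
    (hx : mvV v < x) (o : Option Ty) : TypV (Function.update Γ x o) v A Δ :=
  h.of_eqOn v le_rfl (eqOn_update_of_lt Γ hx o) (Set.eqOn_refl _ _)

theorem TypV.update_right {Γ Δ : Env} {v : Tv} {A : Ty} (h : TypV Γ v A Δ) {a : ℕ}
    (ha : mvV v < a) (o : Option Ty) : TypV Γ v A (Function.update Δ a o) :=
  h.of_eqOn v le_rfl (Set.eqOn_refl _ _) (eqOn_update_of_lt Δ ha o)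

theorem TypE.update_left {Γ Δ : Env} {e : Te} {A : Ty} (h : TypE Γ e A Δ) {x : ℕ}
    (hx : mvE e < x) (o : Option Ty) : TypE (Function.update Γ x o) e A Δ :=
  h.of_eqOn e le_rfl (eqOn_update_of_lt Γ hx o) (Set.eqOn_refl _ _)

theorem TypE.update_right {Γ Δ : Env} {e : Te} {A : Ty} (h : TypE Γ e A Δ) {a : ℕ}
    (ha : mvE e < a) (o : Option Ty) : TypE Γ e A (Function.update Δ a o) :=
  h.of_eqOn e le_rfl (Set.eqOn_refl _ _) (eqOn_update_of_lt Δ ha o)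

/- The expansions of `vτ` and `eτ` are typable as soon as the chosen variable is fresh. -/

theorem TypV.expand_ts {Γ Δ : Env} {v w : Tv} {x a : ℕ} {A B : Ty}
    (hv : TypV (Function.update Γ x (some B)) v A Δ) (hw : TypV Γ w B Δ)
    (hav : mvV v < a) (haw : mvV w < a) :
    TypV Γ (.mu a (.cut (.lam x v) (.vdot w (.cvar a)))) A Δ :=
  .mu (.cut (.lam (hv.update_right hav _))
    (.vdot (hw.update_right haw _) (.cvar (Function.update_self ..))))

theorem TypV.expand_cs {Γ Δ : Env} {v : Tv} {e : Te} {a b : ℕ} {A B : Ty}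
    (hv : TypV Γ v A (Function.update Δ a (some B))) (he : TypE Γ e B Δ)
    (hbv : mvV v < b) (hbe : mvE e < b) (hab : a < b) :
    TypV Γ (.mu b (.cut (.mu a (.cut v (.cvar b))) e)) A Δ := by
  refine .mu (.cut (.mu (A := B) ?_) (he.update_right hbe _))
  rw [Function.update_comm hab.ne']
  exact .cut (hv.update_right hbv _) (.cvar (Function.update_self ..))

theorem TypE.expand_ts {Γ Δ : Env} {e : Te} {v : Tv} {x y : ℕ} {A B : Ty}
    (he : TypE (Function.update Γ x (some B)) e A Δ) (hv : TypV Γ v B Δ)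
    (hye : mvE e < y) (hyv : mvV v < y) (hxy : x < y) :
    TypE Γ (.mut y (.cut v (.mut x (.cut (.tvar y) e)))) A Δ := by
  refine .mut (.cut (hv.update_left hyv _) (.mut ?_))
  rw [Function.update_comm hxy.ne']
  exact .cut (.tvar (Function.update_self ..)) (he.update_left hye _)

theorem TypE.expand_cs {Γ Δ : Env} {e f : Te} {a x : ℕ} {A B : Ty}
    (he : TypE Γ e A (Function.update Δ a (some B))) (hf : TypE Γ f B Δ)
    (hxe : mvE e < x) (hxf : mvE f < x) :
    TypE Γ (.mut x (.cut (.edot f (.tvar x)) (.colam a e))) A Δ :=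
  .mut (.cut (.edot (.tvar (Function.update_self ..)) (hf.update_left hxf _))
    (.colam (he.update_left hxe _)))

mutual
theorem TypC.atebC {Γ Δ : Env} : (c : Cmd) → TypC Γ c Δ → TypC Γ (AtebC c) Δ
  | .cut v e, h => by
    rw [AtebC]
    cases h with
    | cut hv he => exact .cut (hv.atebV v) (he.atebE e)
  | .csub c (.ts x v), h => by
    rw [AtebC]
    cases h with
    | csub hc hτ =>
      cases hτ with
      | ts hv =>
        exact .cut (hv.atebV v) (.mut (hc.atebC c))
  | .csub c (.cs a e), h => by
    rw [AtebC]
    cases h with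
    | csub hc hτ =>
      cases hτ with
      | cs he =>
        exact .cut (.mu (hc.atebC c)) (he.atebE e)

theorem TypV.atebV {Γ Δ : Env} {A : Ty} : (v : Tv) → TypV Γ v A Δ → TypV Γ (AtebV v) A Δ
  | .tvar x, h => by rwa [AtebV]
  | .lam x v, h => by
    rw [AtebV]
    cases h with
    | lam hv => exact .lam (hv.atebV v)
  | .edot e v, h => by
    rw [AtebV]
    cases h with
    | edot hv he => exact .edot (hv.atebV v) (he.atebE e)
  | .mu a c, h => by
    rw [AtebV]
    cases h with
    | mu hc => exact .mu (hc.atebC c)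
  | .vsub v (.ts x w), h => by
    rw [AtebV]
    cases h with
    | vsub hv hτ =>
      cases hτ with
      | ts hw => exact (hv.atebV v).expand_ts (hw.atebV w) (by omega) (by omega)
  | .vsub v (.cs a e), h => by
    rw [AtebV]
    cases h with
    | vsub hv hτ =>
      cases hτ with
      | cs he => exact (hv.atebV v).expand_cs (he.atebE e) (by omega) (by omega) (by omega)

theorem TypE.atebE {Γ Δ : Env} {A : Ty} : (e : Te) → TypE Γ e A Δ → TypE Γ (AtebE e) A Δ
  | .cvar a, h => by rwa [AtebE]
  | .colam a e, h => by
    rw [AtebE]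
    cases h with
    | colam he => exact .colam (he.atebE e)
  | .vdot v e, h => by
    rw [AtebE]
    cases h with
    | vdot hv he => exact .vdot (hv.atebV v) (he.atebE e)
  | .mut x c, h => by
    rw [AtebE]
    obtain _ | _ | _ | hc := h
    exact .mut (hc.atebC c)
  | .esub e (.ts x w), h => by
    rw [AtebE]
    cases h with
    | esub he hτ =>
      cases hτ with
      | ts hw => exact (he.atebE e).expand_ts (hw.atebV w) (by omega) (by omega) (by omega)
  | .esub e (.cs a f), h => by
    rw [AtebE]
    cases h with
    | esub he hτ =>
      cases hτ with
      | cs hf => exact (he.atebE e).expand_cs (hf.atebE f) (by omega) (by omega)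
end

/-- The expansion `Ateb` preserves typing: if `c : (Γ ⊢ Δ)` then
`Ateb c : (Γ ⊢ Δ)`; if `Γ ⊢ v : A | Δ` then `Γ ⊢ Ateb v : A | Δ`; and if
`Γ | e : A ⊢ Δ` then `Γ | Ateb e : A ⊢ Δ`. -/
theorem Ateb_typing :
    (∀ (Γ Δ : Env) (c : Cmd), TypC Γ c Δ → TypC Γ (AtebC c) Δ) ∧
    (∀ (Γ Δ : Env) (v : Tv) (A : Ty), TypV Γ v A Δ → TypV Γ (AtebV v) A Δ) ∧
    (∀ (Γ Δ : Env) (e : Te) (A : Ty), TypE Γ e A Δ → TypE Γ (AtebE e) A Δ) := by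
  exact ⟨fun _ _ => TypC.atebC, fun _ _ v _ => TypV.atebV v, fun _ _ e _ => TypE.atebE e⟩

end LambdaBarMuMuTilde
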